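/- g_0(X;Y) > 0 if and only if X is weakly independent of Y, i.e., if and only if the family of vectors {P_{X|Y}(·|y) : y ∈ 𝒴} ⊂ ℝ^𝒳 is linearly dependent. -/

import Mathlib

open scoped BigOperators

noncomputable section

namespace RatePrivacy

variable {α β γ : Type*}

/-- `p` is a probability mass function on a finite alphabet. -/
def IsPMF [Fintype α] (p : α → ℝ) : Prop := (∀ a, 0 ≤ p a) ∧ ∑ a, p a = 1

/-- Shannon entropy (in bits) of the distribution `p`. -/
def ent [Fintype α] (p : α → ℝ) : ℝ := ∑ a, -(p a * Real.logb 2 (p a))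

/-- First marginal of a joint distribution. -/
def margA [Fintype α] [Fintype β] (p : α × β → ℝ) : α → ℝ := fun a => ∑ b, p (a, b)

/-- Second marginal of a joint distribution. -/
def margB [Fintype α] [Fintype β] (p : α × β → ℝ) : β → ℝ := fun b => ∑ a, p (a, b)

/-- Mutual information (in bits) of a joint distribution `p`:
`I(A;B) = H(A) + H(B) - H(A,B)`. -/
def mi [Fintype α] [Fintype β] (p : α × β → ℝ) : ℝ :=
  ent (margA p) + ent (margB p) - ent p

/-- `q` is a (row-stochastic) channel. -/
def IsChannel [Fintype γ] (q : β → γ → ℝ) : Prop :=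
  (∀ y z, 0 ≤ q y z) ∧ ∀ y, ∑ z, q y z = 1

/-- Joint distribution of `(X, Z)` when `Z` is obtained from `Y` through the channel `q`
(so that `X — Y — Z` is a Markov chain). -/
def jointXZ [Fintype α] [Fintype β] [Fintype γ] (p : α × β → ℝ) (q : β → γ → ℝ) :
    α × γ → ℝ := fun xz => ∑ y, p (xz.1, y) * q y xz.2

/-- Joint distribution of `(Y, Z)` when `Z` is obtained from `Y` through the channel `q`. -/
def jointYZ [Fintype α] [Fintype β] [Fintype γ] (p : α × β → ℝ) (q : β → γ → ℝ) :
    β × γ → ℝ := fun yz => margB p yz.1 * q yz.1 yz.2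

/-- Achievable rates `I(Y;Z)` over all privacy filters `Z` (on finite alphabets, wlog `Fin n`)
with `X — Y — Z` Markov and `I(X;Z) ≤ ε`. -/
def gSet [Fintype α] [Fintype β] (p : α × β → ℝ) (ε : ℝ) : Set ℝ :=
  { r | ∃ (n : ℕ) (q : β → Fin n → ℝ), IsChannel q ∧
        mi (jointXZ p q) ≤ ε ∧ r = mi (jointYZ p q) }

/-- The rate-privacy function `g_ε(X;Y)` (privacy measured by mutual information). -/
def g [Fintype α] [Fintype β] (p : α × β → ℝ) (ε : ℝ) : ℝ := sSup (gSet p ε)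

/-- Values `E[f(A) g(B)]` over all zero-mean unit-variance `f, g`, used to define
the Hirschfeld–Gebelein–Rényi maximal correlation. -/
def corrSet [Fintype α] [Fintype β] (p : α × β → ℝ) : Set ℝ :=
  { r | ∃ (f : α → ℝ) (g : β → ℝ),
      (∑ a, margA p a * f a = 0) ∧ (∑ b, margB p b * g b = 0) ∧
      (∑ a, margA p a * (f a) ^ 2 = 1) ∧ (∑ b, margB p b * (g b) ^ 2 = 1) ∧
      r = ∑ x : α × β, p x * (f x.1 * g x.2) }

/-- Maximal correlation `ρ_m(A;B)` (equal to `0` when the constraint set is empty,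
since `sSup ∅ = 0` in `ℝ`). -/
def rhoM [Fintype α] [Fintype β] (p : α × β → ℝ) : ℝ := sSup (corrSet p)

/-- Achievable rates with maximal-correlation privacy constraint `ρ_m²(X;Z) ≤ ε`. -/
def ghSet [Fintype α] [Fintype β] (p : α × β → ℝ) (ε : ℝ) : Set ℝ :=
  { r | ∃ (n : ℕ) (q : β → Fin n → ℝ), IsChannel q ∧
        (rhoM (jointXZ p q)) ^ 2 ≤ ε ∧ r = mi (jointYZ p q) }

/-- The rate-privacy function `ĝ_ε(X;Y)` (privacy measured by squared maximal correlation). -/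
def gh [Fintype α] [Fintype β] (p : α × β → ℝ) (ε : ℝ) : ℝ := sSup (ghSet p ε)

/-- The Kullback–Leibler divergence (in bits) `D(P_{X|Y}(·|y) ‖ P_X)`. -/
def Dxy [Fintype α] [Fintype β] (p : α × β → ℝ) (y : β) : ℝ :=
  ∑ x, (p (x, y) / margB p y) * Real.logb 2 ((p (x, y) / margB p y) / margA p x)

theorem ent_margA_eq_sum [Fintype α] [Fintype β] (p : α × β → ℝ) :
    ent (margA p) = ∑ x : α × β, -(p x * Real.logb 2 (margA p x.1)) := by
  rw [Fintype.sum_prod_type]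
  simp only [ent, Finset.sum_neg_distrib, ← Finset.sum_mul]
  rfl

theorem ent_margB_eq_sum [Fintype α] [Fintype β] (p : α × β → ℝ) :
    ent (margB p) = ∑ x : α × β, -(p x * Real.logb 2 (margB p x.2)) := by
  rw [Fintype.sum_prod_type_right]
  simp only [ent, Finset.sum_neg_distrib, ← Finset.sum_mul]
  rfl

theorem le_margA [Fintype α] [Fintype β] {p : α × β → ℝ} (hp : ∀ x, 0 ≤ p x) (x : α × β) :
    p x ≤ margA p x.1 :=
  Finset.single_le_sum (f := fun b => p (x.1, b)) (fun _ _ => hp _) (Finset.mem_univ x.2)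

theorem le_margB [Fintype α] [Fintype β] {p : α × β → ℝ} (hp : ∀ x, 0 ≤ p x) (x : α × β) :
    p x ≤ margB p x.2 :=
  Finset.single_le_sum (f := fun a => p (a, x.2)) (fun _ _ => hp _) (Finset.mem_univ x.1)

theorem sum_margA_mul_margB [Fintype α] [Fintype β] {p : α × β → ℝ} (hp : IsPMF p) :
    ∑ x : α × β, margA p x.1 * margB p x.2 = 1 := by
  have hA : ∑ a, margA p a = 1 := by
    rw [← hp.2, Fintype.sum_prod_type]; rfl
  have hB : ∑ b, margB p b = 1 := by
    rw [← hp.2, Fintype.sum_prod_type_right]; rfl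
  rw [Fintype.sum_prod_type]
  simp only [← Finset.mul_sum, hB, mul_one, hA]

/-- Mutual information never exceeds the entropy of the first component. -/
theorem mi_le_ent_margA [Fintype α] [Fintype β] {p : α × β → ℝ} (hp : ∀ x, 0 ≤ p x) :
    mi p ≤ ent (margA p) := by
  have h : ent (margB p) ≤ ent p := by
    rw [ent_margB_eq_sum]
    refine Finset.sum_le_sum fun x _ => neg_le_neg ?_
    rcases (hp x).eq_or_lt with h0 | h0
    · simp [← h0]
    · exact mul_le_mul_of_nonneg_left
        (Real.logb_le_logb_of_le (by norm_num) h0 (le_margB hp x)) h0.le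
  unfold mi
  linarith

/-- The pointwise gap in `log t ≤ t - 1`, scaled by `u`, at `t = s / u`. -/
def logGap (u s t : ℝ) : ℝ :=
  s * t - u - u * (Real.log s + Real.log t - Real.log u)

theorem logGap_nonneg {u s t : ℝ} (hu : 0 ≤ u) (hs : u ≤ s) (ht : u ≤ t) :
    0 ≤ logGap u s t := by
  unfold logGap
  rcases hu.eq_or_lt with rfl | h0
  · simpa using mul_nonneg hs ht
  · have hs0 := h0.trans_le hs
    have ht0 := h0.trans_le ht
    have h := Real.log_le_sub_one_of_pos (show 0 < s * t / u by positivity)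
    rw [Real.log_div (by positivity) h0.ne', Real.log_mul hs0.ne' ht0.ne'] at h
    have h' := mul_le_mul_of_nonneg_left h h0.le
    have : u * (s * t / u - 1) = s * t - u := by field_simp
    linarith

theorem eq_mul_of_logGap_eq_zero {u s t : ℝ} (hu : 0 ≤ u) (hs : u ≤ s) (ht : u ≤ t)
    (h : logGap u s t = 0) : u = s * t := by
  unfold logGap at h
  rcases hu.eq_or_lt with rfl | h0
  · simpa using h.symm
  · have hs0 := h0.trans_le hs
    have ht0 := h0.trans_le ht
    by_contra hne
    have hlt := Real.log_lt_sub_one_of_pos (show 0 < s * t / u by positivity)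
      (fun h1 => hne ((div_eq_one_iff_eq h0.ne').1 h1).symm)
    rw [Real.log_div (by positivity) h0.ne', Real.log_mul hs0.ne' ht0.ne'] at hlt
    have h' := mul_lt_mul_of_pos_left hlt h0
    have : u * (s * t / u - 1) = s * t - u := by field_simp
    linarith

theorem mi_mul_log_two [Fintype α] [Fintype β] {p : α × β → ℝ} (hp : IsPMF p) :
    mi p * Real.log 2 = ∑ x, logGap (p x) (margA p x.1) (margB p x.2) := by
  have h2 : Real.log 2 ≠ 0 := (Real.log_pos (by norm_num)).ne'
  have hsum : ∑ x : α × β, (margA p x.1 * margB p x.2 - p x) = 0 := by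
    rw [Finset.sum_sub_distrib, sum_margA_mul_margB hp, hp.2, sub_self]
  rw [← add_zero (mi p * Real.log 2), ← hsum, mi, ent_margA_eq_sum, ent_margB_eq_sum, ent,
    ← Finset.sum_add_distrib, ← Finset.sum_sub_distrib, Finset.sum_mul, ← Finset.sum_add_distrib]
  refine Finset.sum_congr rfl fun x _ => ?_
  unfold logGap Real.logb
  field_simp
  ring

theorem mi_nonneg [Fintype α] [Fintype β] {p : α × β → ℝ} (hp : IsPMF p) : 0 ≤ mi p := by
  refine nonneg_of_mul_nonneg_left ?_ (Real.log_pos (one_lt_two : (1 : ℝ) < 2))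
  rw [mi_mul_log_two hp]
  exact Finset.sum_nonneg fun x _ => logGap_nonneg (hp.1 x) (le_margA hp.1 x) (le_margB hp.1 x)

/-- Mutual information vanishes exactly for product distributions. -/
theorem mi_eq_zero_iff [Fintype α] [Fintype β] {p : α × β → ℝ} (hp : IsPMF p) :
    mi p = 0 ↔ ∀ a b, p (a, b) = margA p a * margB p b := by
  constructor
  · intro h a b
    have h0 := mi_mul_log_two hp
    rw [h, zero_mul, eq_comm, Finset.sum_eq_zero_iff_of_nonneg fun x _ =>
      logGap_nonneg (hp.1 x) (le_margA hp.1 x) (le_margB hp.1 x)] at h0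
    exact eq_mul_of_logGap_eq_zero (hp.1 _) (le_margA hp.1 (a, b)) (le_margB hp.1 (a, b))
      (h0 (a, b) (Finset.mem_univ _))
  · intro h
    have h0 := mi_mul_log_two hp
    rw [Finset.sum_eq_zero] at h0
    · exact (mul_eq_zero.1 h0).resolve_right (Real.log_pos (by norm_num)).ne'
    · rintro ⟨a, b⟩ -
      have hab := h a b
      unfold logGap
      by_cases hz : p (a, b) = 0
      · simp [hz, ← hab]
      · have hm : margA p a * margB p b ≠ 0 := hab ▸ hz
        rw [← Real.log_mul (left_ne_zero_of_mul hm) (right_ne_zero_of_mul hm), ← hab]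
        ring

section Channel

variable [Fintype α] [Fintype β] [Fintype γ]

theorem margA_jointXZ (p : α × β → ℝ) {q : β → γ → ℝ} (hq : IsChannel q) :
    margA (jointXZ p q) = margA p := by
  funext x
  simp only [margA, jointXZ]
  rw [Finset.sum_comm]
  simp [← Finset.mul_sum, hq.2]

theorem margA_jointYZ (p : α × β → ℝ) {q : β → γ → ℝ} (hq : IsChannel q) :
    margA (jointYZ p q) = margB p := by
  funext y
  simp [margA, jointYZ, ← Finset.mul_sum, hq.2]

theorem margB_jointXZ (p : α × β → ℝ) (q : β → γ → ℝ) :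
    margB (jointXZ p q) = margB (jointYZ p q) := by
  funext z
  simp only [margB, jointXZ, jointYZ]
  rw [Finset.sum_comm]
  simp [Finset.sum_mul]

theorem isPMF_jointXZ {p : α × β → ℝ} (hp : IsPMF p) {q : β → γ → ℝ} (hq : IsChannel q) :
    IsPMF (jointXZ p q) := by
  refine ⟨fun x => Finset.sum_nonneg fun y _ => mul_nonneg (hp.1 _) (hq.1 _ _), ?_⟩
  rw [← hp.2, Fintype.sum_prod_type, Fintype.sum_prod_type]
  exact Finset.sum_congr rfl fun x _ => congrFun (margA_jointXZ p hq) x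

theorem isPMF_jointYZ {p : α × β → ℝ} (hp : IsPMF p) {q : β → γ → ℝ} (hq : IsChannel q) :
    IsPMF (jointYZ p q) := by
  refine ⟨fun x => mul_nonneg (Finset.sum_nonneg fun _ _ => hp.1 _) (hq.1 _ _), ?_⟩
  rw [← hp.2, Fintype.sum_prod_type, Fintype.sum_prod_type_right]
  exact Finset.sum_congr rfl fun y _ => congrFun (margA_jointYZ p hq) y

theorem bddAbove_gSet {p : α × β → ℝ} (hp : IsPMF p) (ε : ℝ) : BddAbove (gSet p ε) := by
  refine ⟨ent (margB p), ?_⟩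
  rintro _ ⟨n, q, hq, -, rfl⟩
  exact margA_jointYZ p hq ▸ mi_le_ent_margA (isPMF_jointYZ hp hq).1

/-- If the conditional distributions of `X` given `Y` are linearly independent, a filter output
independent of `X` is independent of `Y`. -/
theorem mi_jointYZ_eq_zero {p : α × β → ℝ} (hp : IsPMF p) (hYpos : ∀ y, 0 < margB p y)
    (hli : LinearIndependent ℝ (fun y : β => (fun x : α => p (x, y) / margB p y)))
    {q : β → γ → ℝ} (hq : IsChannel q) (h : mi (jointXZ p q) = 0) :
    mi (jointYZ p q) = 0 := by
  rw [mi_eq_zero_iff (isPMF_jointXZ hp hq), margA_jointXZ p hq, margB_jointXZ] at h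
  rw [mi_eq_zero_iff (isPMF_jointYZ hp hq), margA_jointYZ p hq]
  intro y z
  have hc := Fintype.linearIndependent_iff.1 hli
    (fun y => margB p y * (q y z - margB (jointYZ p q) z)) ?_ y
  · have := (mul_eq_zero.1 hc).resolve_left (hYpos y).ne'
    simp only [jointYZ] at this ⊢
    rw [sub_eq_zero.1 this]
  · funext x
    have hx := h x z
    simp only [jointXZ, margA, Finset.sum_mul] at hx
    simp only [Finset.sum_apply, Pi.smul_apply, smul_eq_mul, Pi.zero_apply]
    rw [← sub_eq_zero.2 hx, ← Finset.sum_sub_distrib]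
    refine Finset.sum_congr rfl fun y _ => ?_
    have := (hYpos y).ne'
    field_simp

/-- If the conditional distributions of `X` given `Y` are linearly dependent, there is a binary
filter whose output is independent of `X` but not of `Y`. -/
theorem exists_binary_filter {p : α × β → ℝ} (hp : IsPMF p) (hYpos : ∀ y, 0 < margB p y)
    (hld : ¬ LinearIndependent ℝ (fun y : β => (fun x : α => p (x, y) / margB p y))) :
    ∃ q : β → Fin 2 → ℝ, IsChannel q ∧ mi (jointXZ p q) = 0 ∧ 0 < mi (jointYZ p q) := by
  obtain ⟨c, hc, y₀, hy₀⟩ := Fintype.not_linearIndependent_iff.1 hld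
  have hcx : ∀ x, ∑ y, p (x, y) * (c y / margB p y) = 0 := fun x => by
    have := congrFun hc x
    simp only [Finset.sum_apply, Pi.smul_apply, smul_eq_mul, Pi.zero_apply] at this
    rw [← this]
    exact Finset.sum_congr rfl fun y _ => by ring
  set d : β → ℝ := fun y => c y / margB p y
  have hd₀ : d y₀ ≠ 0 := div_ne_zero hy₀ (hYpos y₀).ne'
  set M : ℝ := ∑ y, |d y|
  have hdM : ∀ y, |d y| ≤ M := fun y =>
    Finset.single_le_sum (f := fun y => |d y|) (fun _ _ => abs_nonneg _) (Finset.mem_univ y)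
  have hM0 : 0 < M := (abs_pos.2 hd₀).trans_le (hdM y₀)
  set e : β → ℝ := fun y => d y / (2 * M) with he
  have he₀ : e y₀ ≠ 0 := div_ne_zero hd₀ (by positivity)
  have heb : ∀ y, |e y| ≤ 1 / 2 := fun y => by
    rw [he, abs_div, abs_of_pos (by positivity : 0 < 2 * M), div_le_div_iff₀ (by positivity) two_pos]
    linarith [hdM y]
  have hex : ∀ x, ∑ y, p (x, y) * e y = 0 := fun x => by
    simp only [he, ← mul_div_assoc, ← Finset.sum_div]
    exact div_eq_zero_iff.2 (Or.inl (hcx x))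
  let s : Fin 2 → ℝ := ![1, -1]
  let q : β → Fin 2 → ℝ := fun y z => 1 / 2 + s z * e y
  have hq : IsChannel q := by
    refine ⟨fun y z => ?_, fun y => ?_⟩
    · have := abs_le.1 (heb y)
      fin_cases z <;> simp [q, s] <;> linarith
    · simp [q, s, Fin.sum_univ_two]
      ring
  have hXZ : ∀ x z, jointXZ p q (x, z) = margA p x * (1 / 2) := fun x z => by
    have : s z * ∑ y, p (x, y) * e y = 0 := by rw [hex, mul_zero]
    simp only [jointXZ, margA, q]
    rw [← add_zero ((∑ y, p (x, y)) * (1 / 2)), ← this, Finset.sum_mul, Finset.mul_sum,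
      ← Finset.sum_add_distrib]
    exact Finset.sum_congr rfl fun y _ => by ring
  have hZ : ∀ z, margB (jointXZ p q) z = 1 / 2 := fun z => by
    simp only [margB, hXZ, ← Finset.sum_mul]
    have : ∑ x, margA p x = 1 := by rw [← hp.2, Fintype.sum_prod_type]; rfl
    rw [this, one_mul]
  refine ⟨q, hq, ?_, (mi_nonneg (isPMF_jointYZ hp hq)).lt_of_ne' fun h0 => he₀ ?_⟩
  · rw [mi_eq_zero_iff (isPMF_jointXZ hp hq), margA_jointXZ p hq]
    intro x z
    rw [hXZ, hZ]
  · have h := (mi_eq_zero_iff (isPMF_jointYZ hp hq)).1 h0 y₀ 0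
    rw [margA_jointYZ p hq, ← margB_jointXZ, hZ] at h
    have := mul_left_cancel₀ (hYpos y₀).ne' h
    simpa [q, s] using this

end Channel

/-- `g_0(X;Y) > 0` if and only if `X` is weakly independent of `Y`, i.e.,
iff the family of conditional distributions `{P_{X|Y}(·|y) : y ∈ 𝒴} ⊆ ℝ^𝒳` is linearly
dependent. -/
theorem stmt6 {𝓧 𝓨 : Type*} [Fintype 𝓧] [Fintype 𝓨]
    (p : 𝓧 × 𝓨 → ℝ) (hp : IsPMF p) (hYpos : ∀ y, 0 < margB p y) :
    0 < g p 0 ↔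
      ¬ LinearIndependent ℝ (fun y : 𝓨 => (fun x : 𝓧 => p (x, y) / margB p y)) := by
  constructor
  · intro h hli
    refine h.not_ge (Real.sSup_nonpos ?_)
    rintro _ ⟨n, q, hq, hXZ, rfl⟩
    exact (mi_jointYZ_eq_zero hp hYpos hli hq
      (hXZ.antisymm (mi_nonneg (isPMF_jointXZ hp hq)))).le
  · intro hld
    obtain ⟨q, hq, hXZ, hYZ⟩ := exists_binary_filter hp hYpos hld
    exact hYZ.trans_le (le_csSup (bddAbove_gSet hp 0) ⟨2, q, hq, hXZ.le, rfl⟩)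

end RatePrivacy
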